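/- Let Γ be a simple graph with vertex set S, let (G_s)_{s∈S} be a family of groups with graph product G_Γ, and let s₁ ∈ S. Let L, A and K denote the graph products of the families (G_s) over the induced subgraphs of Γ on the vertex sets link(s₁), star(s₁) and S ∖ {s₁}, respectively. Then: (a) the homomorphism G_{s₁} × L → A induced by the canonical maps of G_{s₁} and of the G_s, s ∈ link(s₁), into A is an isomorphism; (b) the homomorphism to G_Γ from the pushout of the canonical homomorphisms L → A and L → K (induced by the inclusions of vertex sets), itself induced by the canonical maps A → G_Γ and K → G_Γ, is an isomorphism; that is, G_Γ ≅ (G_{s₁} × L) ∗_L K. -/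

import Mathlib

/-- The commutation relators defining the graph product of a family of groups `(G s)`
over a simple graph `Γ`: the commutators `[g, h]` with `g ∈ G s`, `h ∈ G t` and `s, t`
adjacent in `Γ`, viewed inside the free product `Monoid.CoprodI G`. -/
def graphProductRels {S : Type*} (Γ : SimpleGraph S) (G : S → Type*) [∀ s, Group (G s)] :
    Set (Monoid.CoprodI G) :=
  {x | ∃ (s t : S) (g : G s) (h : G t), Γ.Adj s t ∧
    x = Monoid.CoprodI.of g * Monoid.CoprodI.of h *
      (Monoid.CoprodI.of g)⁻¹ * (Monoid.CoprodI.of h)⁻¹}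

/-- The graph product of a family of groups `(G s)_{s ∈ S}` over a simple graph `Γ`:
the quotient of the free product of the `G s` by the normal closure of the commutators
`[g, h]` with `g ∈ G s`, `h ∈ G t` and `s, t` adjacent in `Γ`. -/
def GraphProduct {S : Type*} (Γ : SimpleGraph S) (G : S → Type*) [∀ s, Group (G s)] :
    Type _ :=
  Monoid.CoprodI G ⧸ Subgroup.normalClosure (graphProductRels Γ G)

instance {S : Type*} (Γ : SimpleGraph S) (G : S → Type*) [∀ s, Group (G s)] :
    Group (GraphProduct Γ G) :=
  inferInstanceAs (Group (Monoid.CoprodI G ⧸ Subgroup.normalClosure (graphProductRels Γ G)))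

/-- The canonical homomorphism from each vertex group into the graph product. -/
def GraphProduct.of {S : Type*} (Γ : SimpleGraph S) (G : S → Type*) [∀ s, Group (G s)]
    (s : S) : G s →* GraphProduct Γ G :=
  (QuotientGroup.mk' (Subgroup.normalClosure (graphProductRels Γ G))).comp
    (Monoid.CoprodI.of (i := s))

/-- A two-element family of groups, used to form the amalgamated free product `A ∗_L K`
as an indexed pushout over `Bool`. -/
def AmalgFam (A K : Type u) : Bool → Type u := fun b => cond b A K

instance {A K : Type u} [Group A] [Group K] : ∀ b, Group (AmalgFam A K b)
  | true => inferInstanceAs (Group A)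
  | false => inferInstanceAs (Group K)

/-- The pair of homomorphisms from the amalgamating group `L` to `A` and `K`. -/
def amalgMaps {L : Type*} {A K : Type u} [Group L] [Group A] [Group K]
    (f : L →* A) (g : L →* K) : ∀ b, L →* AmalgFam A K b
  | true => f
  | false => g

/-- The amalgamated free product `A ∗_L K` of two groups over `L`, with respect to
homomorphisms `f : L →* A` and `g : L →* K`, as a pushout in the category of groups. -/
def Amalg {L : Type*} {A K : Type u} [Group L] [Group A] [Group K]
    (f : L →* A) (g : L →* K) : Type _ :=
  Monoid.PushoutI (amalgMaps f g)

instance {L : Type*} {A K : Type u} [Group L] [Group A] [Group K] (f : L →* A) (g : L →* K) :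
    Group (Amalg f g) :=
  inferInstanceAs (Group (Monoid.PushoutI (amalgMaps f g)))

/-- The canonical map `A →* A ∗_L K`. -/
def Amalg.inlHom {L : Type*} {A K : Type u} [Group L] [Group A] [Group K]
    (f : L →* A) (g : L →* K) : A →* Amalg f g :=
  Monoid.PushoutI.of (φ := amalgMaps f g) true

/-- The canonical map `K →* A ∗_L K`. -/
def Amalg.inrHom {L : Type*} {A K : Type u} [Group L] [Group A] [Group K]
    (f : L →* A) (g : L →* K) : K →* Amalg f g :=
  Monoid.PushoutI.of (φ := amalgMaps f g) false

/-- The graph product of `(G s)` over the induced subgraph of `Γ` on `link s₁`. -/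
def LinkProd {S : Type*} (Γ : SimpleGraph S) (G : S → Type*) [∀ s, Group (G s)] (s₁ : S) :
    Type _ :=
  GraphProduct (Γ.induce (Γ.neighborSet s₁)) (fun t => G t.1)

instance {S : Type*} (Γ : SimpleGraph S) (G : S → Type*) [∀ s, Group (G s)] (s₁ : S) :
    Group (LinkProd Γ G s₁) :=
  inferInstanceAs (Group (GraphProduct (Γ.induce (Γ.neighborSet s₁)) (fun t => G t.1)))

/-- The graph product of `(G s)` over the induced subgraph of `Γ` on `star s₁`. -/
def StarProd {S : Type*} (Γ : SimpleGraph S) (G : S → Type*) [∀ s, Group (G s)] (s₁ : S) :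
    Type _ :=
  GraphProduct (Γ.induce (insert s₁ (Γ.neighborSet s₁))) (fun t => G t.1)

instance {S : Type*} (Γ : SimpleGraph S) (G : S → Type*) [∀ s, Group (G s)] (s₁ : S) :
    Group (StarProd Γ G s₁) :=
  inferInstanceAs
    (Group (GraphProduct (Γ.induce (insert s₁ (Γ.neighborSet s₁))) (fun t => G t.1)))

/-- The graph product of `(G s)` over the induced subgraph of `Γ` on `S ∖ {s₁}`. -/
def CompProd {S : Type*} (Γ : SimpleGraph S) (G : S → Type*) [∀ s, Group (G s)] (s₁ : S) :
    Type _ :=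
  GraphProduct (Γ.induce ({s₁}ᶜ : Set S)) (fun t => G t.1)

instance {S : Type*} (Γ : SimpleGraph S) (G : S → Type*) [∀ s, Group (G s)] (s₁ : S) :
    Group (CompProd Γ G s₁) :=
  inferInstanceAs (Group (GraphProduct (Γ.induce ({s₁}ᶜ : Set S)) (fun t => G t.1)))

theorem GraphProduct.exists_lift {S : Type*} (Γ : SimpleGraph S) (G : S → Type*)
    [∀ s, Group (G s)] {H : Type*} [Group H] (f : ∀ s, G s →* H)
    (hf : ∀ s t, Γ.Adj s t → ∀ (g : G s) (h : G t), Commute (f s g) (f t h)) :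
    ∃ F : GraphProduct Γ G →* H, ∀ s x, F (GraphProduct.of Γ G s x) = f s x := by
  refine ⟨QuotientGroup.lift _ (Monoid.CoprodI.lift f) ?_, ?_⟩
  · refine Subgroup.normalClosure_le_normal (N := (Monoid.CoprodI.lift f).ker) ?_
    rintro x ⟨s, t, g, h, hst, rfl⟩
    have := hf s t hst g h
    simp only [SetLike.mem_coe, MonoidHom.mem_ker, map_mul, map_inv, Monoid.CoprodI.lift_of]
    rw [this.eq]
    group
  · intro s x
    exact Monoid.CoprodI.lift_of f x

theorem GraphProduct.hom_ext {S : Type*} (Γ : SimpleGraph S) (G : S → Type*)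
    [∀ s, Group (G s)] {H : Type*} [Group H] (f g : GraphProduct Γ G →* H)
    (h : ∀ s x, f (GraphProduct.of Γ G s x) = g (GraphProduct.of Γ G s x)) : f = g := by
  refine QuotientGroup.monoidHom_ext _ ?_
  refine Monoid.CoprodI.ext_hom _ _ fun s => ?_
  ext x
  exact h s x

theorem GraphProduct.commute_of {S : Type*} (Γ : SimpleGraph S) (G : S → Type*)
    [∀ s, Group (G s)] {s t : S} (hst : Γ.Adj s t) (g : G s) (h : G t) :
    Commute (GraphProduct.of Γ G s g) (GraphProduct.of Γ G t h) := by
  have h1 : (QuotientGroup.mk' (Subgroup.normalClosure (graphProductRels Γ G)))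
      (Monoid.CoprodI.of g * Monoid.CoprodI.of h *
      (Monoid.CoprodI.of g)⁻¹ * (Monoid.CoprodI.of h)⁻¹) = 1 :=
    (QuotientGroup.eq_one_iff _).2 (Subgroup.subset_normalClosure ⟨s, t, g, h, hst, rfl⟩)
  rw [map_mul, map_mul, map_mul, map_inv, map_inv, mul_inv_eq_one, mul_inv_eq_iff_eq_mul] at h1
  exact h1

/-- Two homs commuting on generators commute everywhere. -/
theorem GraphProduct.commute_all {S : Type*} (Γ : SimpleGraph S) (G : S → Type*)
    [∀ s, Group (G s)] {H : Type*} [Group H] (f : GraphProduct Γ G →* H) (y : H)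
    (h : ∀ s x, Commute y (f (GraphProduct.of Γ G s x))) (z : GraphProduct Γ G) :
    Commute y (f z) := by
  have : (MulAut.conj y).toMonoidHom.comp f = f := by
    refine GraphProduct.hom_ext Γ G _ _ fun s x => ?_
    have := (h s x).eq
    simp [this]
  have h2 := DFunLike.congr_fun this z
  simp only [MonoidHom.comp_apply, MulEquiv.coe_toMonoidHom, MulAut.conj_apply,
    mul_inv_eq_iff_eq_mul] at h2
  exact h2

/-- Choose one hom at `s₁` and others elsewhere. -/
theorem exists_split {S : Type*} {T : Type*} (p : T → S) (G : S → Type*) [∀ s, Group (G s)]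
    {H : Type*} [Group H]
    (s₁ : S) (f₁ : G s₁ →* H) (f₂ : ∀ t : T, p t ≠ s₁ → G (p t) →* H) :
    ∃ f : ∀ t : T, G (p t) →* H,
      (∀ t (h : p t = s₁) (x : G (p t)), f t x = f₁ (h ▸ x)) ∧
      (∀ t (h : p t ≠ s₁) x, f t x = f₂ t h x) := by
  classical
  have key : ∀ t : T, ∃ f : G (p t) →* H, (∀ (h : p t = s₁) (x : G (p t)), f x = f₁ (h ▸ x)) ∧
      (∀ (h : p t ≠ s₁) x, f x = f₂ t h x) := by
    intro t
    by_cases h : p t = s₁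
    · have : ∀ (s : S) (h : s = s₁), ∃ f : G s →* H, ∀ x : G s, f x = f₁ (h ▸ x) := by
        rintro s rfl
        exact ⟨f₁, fun _ => rfl⟩
      obtain ⟨f, hf⟩ := this _ h
      exact ⟨f, fun _ => hf, fun h' => absurd h h'⟩
    · exact ⟨f₂ t h, fun h' => absurd h' h, fun _ _ => rfl⟩
  choose f hf using key
  exact ⟨f, fun t => (hf t).1, fun t => (hf t).2⟩

theorem star_part {S : Type*} (Γ : SimpleGraph S)
    (G : S → Type*) [∀ s, Group (G s)] (s₁ : S)
    (ℓA : LinkProd Γ G s₁ →* StarProd Γ G s₁)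
    (hA : ∀ (t : ↥(Γ.neighborSet s₁)) (x : G t.1),
        ℓA (GraphProduct.of (Γ.induce (Γ.neighborSet s₁)) (fun t => G t.1) t x) =
          GraphProduct.of (Γ.induce (insert s₁ (Γ.neighborSet s₁))) (fun t => G t.1)
            ⟨t.1, Set.mem_insert_of_mem s₁ t.2⟩ x) :
    (∃ θ : G s₁ × LinkProd Γ G s₁ →* StarProd Γ G s₁,
      (∀ x : G s₁,
        θ (x, 1) =
          GraphProduct.of (Γ.induce (insert s₁ (Γ.neighborSet s₁))) (fun t => G t.1)
            ⟨s₁, Set.mem_insert s₁ _⟩ x) ∧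
      (∀ (t : ↥(Γ.neighborSet s₁)) (x : G t.1),
        θ (1, GraphProduct.of (Γ.induce (Γ.neighborSet s₁)) (fun t => G t.1) t x) =
          GraphProduct.of (Γ.induce (insert s₁ (Γ.neighborSet s₁))) (fun t => G t.1)
            ⟨t.1, Set.mem_insert_of_mem s₁ t.2⟩ x) ∧
      Function.Bijective θ) := by
  let o : G s₁ →* StarProd Γ G s₁ :=
    GraphProduct.of (Γ.induce (insert s₁ (Γ.neighborSet s₁))) (fun t => G t.1)
            ⟨s₁, Set.mem_insert s₁ _⟩
  have hcomm : ∀ m n, Commute (o m) (ℓA n) := by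
    intro m n
    refine GraphProduct.commute_all (Γ.induce (Γ.neighborSet s₁)) (fun t => G t.1) ℓA (o m) ?_ n
    intro t x
    refine Eq.subst (motive := fun z => Commute (o m) z) (hA t x).symm ?_
    refine GraphProduct.commute_of (Γ.induce (insert s₁ (Γ.neighborSet s₁))) (fun t => G t.1)
      (s := ⟨s₁, Set.mem_insert s₁ _⟩) (t := ⟨t.1, Set.mem_insert_of_mem s₁ t.2⟩) ?_ m x
    exact t.2
  let θ : G s₁ × LinkProd Γ G s₁ →* StarProd Γ G s₁ := MonoidHom.noncommCoprod o ℓA hcomm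
  have hθ : ∀ a b, θ (a, b) = o a * ℓA b := fun a b => rfl
  have hθ1 : ∀ a, θ (a, 1) = o a := fun a => by rw [hθ, map_one, mul_one]
  have hθ2 : ∀ b, θ (1, b) = ℓA b := fun a => by rw [hθ, map_one, one_mul]
  -- the inverse
  let oL : ∀ t : ↥(Γ.neighborSet s₁), G t.1 →* LinkProd Γ G s₁ := fun t =>
    GraphProduct.of (Γ.induce (Γ.neighborSet s₁)) (fun t => G t.1) t
  obtain ⟨f, hf1, hf2⟩ := exists_split
    (fun t : ↥(insert s₁ (Γ.neighborSet s₁) : Set S) => t.1) G s₁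
    (MonoidHom.inl (G s₁) (LinkProd Γ G s₁))
    (fun t ht => (MonoidHom.inr (G s₁) (LinkProd Γ G s₁)).comp
      (oL ⟨t.1, t.2.resolve_left ht⟩))
  obtain ⟨F, hF⟩ := GraphProduct.exists_lift (Γ.induce (insert s₁ (Γ.neighborSet s₁)))
    (fun t => G t.1) f (by
      rintro ⟨s, hs⟩ ⟨t, ht⟩ hst g h
      by_cases h1 : s = s₁
      · subst h1
        have h2 : t ≠ s := fun h => Γ.ne_of_adj hst h.symm
        rw [hf1 ⟨s, hs⟩ rfl, hf2 ⟨t, ht⟩ h2]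
        exact MonoidHom.commute_inl_inr _ _
      · by_cases h2 : t = s₁
        · subst h2
          rw [hf1 ⟨t, ht⟩ rfl, hf2 ⟨s, hs⟩ h1]
          exact (MonoidHom.commute_inl_inr _ _).symm
        · rw [hf2 ⟨s, hs⟩ h1, hf2 ⟨t, ht⟩ h2]
          refine Commute.map ?_ (MonoidHom.inr (G s₁) (LinkProd Γ G s₁))
          exact GraphProduct.commute_of (Γ.induce (Γ.neighborSet s₁)) (fun t => G t.1)
            (s := ⟨s, hs.resolve_left h1⟩) (t := ⟨t, ht.resolve_left h2⟩) hst g h)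
  let F' : StarProd Γ G s₁ →* G s₁ × LinkProd Γ G s₁ := F
  refine ⟨θ, hθ1, fun t x => (hθ2 _).trans (hA t x), ?_⟩
  have hFo : ∀ a, F' (o a) = (a, 1) := fun a => by
    refine (hF _ _).trans ?_
    exact hf1 ⟨s₁, Set.mem_insert s₁ _⟩ rfl a
  have hFl : F'.comp ℓA = MonoidHom.inr _ _ := by
    refine GraphProduct.hom_ext (Γ.induce (Γ.neighborSet s₁)) (fun t => G t.1) _ _ ?_
    intro t x
    refine (congrArg F' (hA t x)).trans ((hF _ _).trans ?_)
    exact hf2 ⟨t.1, Set.mem_insert_of_mem s₁ t.2⟩ (Γ.ne_of_adj t.2).symm x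
  have hr : θ.comp F' = MonoidHom.id _ := by
    refine GraphProduct.hom_ext (Γ.induce (insert s₁ (Γ.neighborSet s₁))) (fun t => G t.1) _ _ ?_
    rintro ⟨t, ht⟩ x
    refine (congrArg θ (hF _ _)).trans ?_
    by_cases h : t = s₁
    · subst h
      rw [hf1 ⟨t, ht⟩ rfl]
      exact hθ1 x
    · rw [hf2 ⟨t, ht⟩ h]
      exact (hθ2 _).trans (hA ⟨t, ht.resolve_left h⟩ x)
  refine Function.bijective_iff_has_inverse.2 ⟨F', ?_, fun y => DFunLike.congr_fun hr y⟩
  rintro ⟨a, b⟩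
  have hb : F' (ℓA b) = (1, b) := DFunLike.congr_fun hFl b
  rw [hθ, map_mul, hFo, hb]
  simp

theorem amalg_part {S : Type*} (Γ : SimpleGraph S)
    (G : S → Type*) [∀ s, Group (G s)] (s₁ : S)
    (ℓA : LinkProd Γ G s₁ →* StarProd Γ G s₁)
    (ℓK : LinkProd Γ G s₁ →* CompProd Γ G s₁)
    (ιA : StarProd Γ G s₁ →* GraphProduct Γ G)
    (ιK : CompProd Γ G s₁ →* GraphProduct Γ G)
    (hA : ∀ (t : ↥(Γ.neighborSet s₁)) (x : G t.1),
        ℓA (GraphProduct.of (Γ.induce (Γ.neighborSet s₁)) (fun t => G t.1) t x) =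
          GraphProduct.of (Γ.induce (insert s₁ (Γ.neighborSet s₁))) (fun t => G t.1)
            ⟨t.1, Set.mem_insert_of_mem s₁ t.2⟩ x)
    (hK : ∀ (t : ↥(Γ.neighborSet s₁)) (x : G t.1),
        ℓK (GraphProduct.of (Γ.induce (Γ.neighborSet s₁)) (fun t => G t.1) t x) =
          GraphProduct.of (Γ.induce ({s₁}ᶜ : Set S)) (fun t => G t.1)
            ⟨t.1, Set.mem_compl_singleton_iff.mpr (Γ.ne_of_adj t.2).symm⟩ x)
    (hιA : ∀ (a : ↥(insert s₁ (Γ.neighborSet s₁) : Set S)) (x : G a.1),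
        ιA (GraphProduct.of (Γ.induce (insert s₁ (Γ.neighborSet s₁))) (fun t => G t.1) a x) =
          GraphProduct.of Γ G a.1 x)
    (hιK : ∀ (a : ↥({s₁}ᶜ : Set S)) (x : G a.1),
        ιK (GraphProduct.of (Γ.induce ({s₁}ᶜ : Set S)) (fun t => G t.1) a x) =
          GraphProduct.of Γ G a.1 x) :
    ∃ ψ : Amalg ℓA ℓK →* GraphProduct Γ G,
      (∀ a : StarProd Γ G s₁, ψ (Amalg.inlHom ℓA ℓK a) = ιA a) ∧
      (∀ x : CompProd Γ G s₁, ψ (Amalg.inrHom ℓA ℓK x) = ιK x) ∧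
      Function.Bijective ψ := by
  have hcompat : ιK.comp ℓK = ιA.comp ℓA := by
    refine GraphProduct.hom_ext (Γ.induce (Γ.neighborSet s₁)) (fun t => G t.1) _ _ ?_
    intro t x
    exact ((congrArg ιK (hK t x)).trans (hιK _ _)).trans
      ((congrArg ιA (hA t x)).trans (hιA _ _)).symm
  let fam : ∀ b, AmalgFam (StarProd Γ G s₁) (CompProd Γ G s₁) b →* GraphProduct Γ G :=
    fun b => match b with
      | true => ιA
      | false => ιK
  let ψ : Amalg ℓA ℓK →* GraphProduct Γ G :=
    Monoid.PushoutI.lift (φ := amalgMaps ℓA ℓK) fam (ιA.comp ℓA) (fun b => match b with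
      | true => rfl
      | false => hcompat)
  have h1 : ∀ a : StarProd Γ G s₁, ψ (Amalg.inlHom ℓA ℓK a) = ιA a := fun a =>
    Monoid.PushoutI.lift_of (φ := amalgMaps ℓA ℓK) fam _ _ (i := true) a
  have h2 : ∀ a : CompProd Γ G s₁, ψ (Amalg.inrHom ℓA ℓK a) = ιK a := fun a =>
    Monoid.PushoutI.lift_of (φ := amalgMaps ℓA ℓK) fam _ _ (i := false) a
  have hglue : ∀ x, Amalg.inlHom ℓA ℓK (ℓA x) = Amalg.inrHom ℓA ℓK (ℓK x) := fun x =>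
    (Monoid.PushoutI.of_apply_eq_base (amalgMaps ℓA ℓK) true x).trans
      (Monoid.PushoutI.of_apply_eq_base (amalgMaps ℓA ℓK) false x).symm
  refine ⟨ψ, h1, h2, ?_⟩
  let oA : ∀ t : ↥(insert s₁ (Γ.neighborSet s₁) : Set S), G t.1 →* StarProd Γ G s₁ := fun t =>
    GraphProduct.of (Γ.induce (insert s₁ (Γ.neighborSet s₁))) (fun t => G t.1) t
  let oK : ∀ t : ↥({s₁}ᶜ : Set S), G t.1 →* CompProd Γ G s₁ := fun t =>
    GraphProduct.of (Γ.induce ({s₁}ᶜ : Set S)) (fun t => G t.1) t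
  have hg : ∀ (t : S) (ht : Γ.Adj s₁ t) (x : G t),
      Amalg.inrHom ℓA ℓK (oK ⟨t, (Γ.ne_of_adj ht).symm⟩ x) =
      Amalg.inlHom ℓA ℓK (oA ⟨t, Set.mem_insert_of_mem s₁ ht⟩ x) := by
    intro t ht x
    refine (congrArg (Amalg.inrHom ℓA ℓK) (hK ⟨t, ht⟩ x)).symm.trans ?_
    exact (hglue _).symm.trans (congrArg (Amalg.inlHom ℓA ℓK) (hA ⟨t, ht⟩ x))
  have hcomm : ∀ (t : S) (ht : Γ.Adj s₁ t) (x : G s₁) (y : G t),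
      Commute (Amalg.inlHom ℓA ℓK (oA ⟨s₁, Set.mem_insert s₁ _⟩ x))
        (Amalg.inrHom ℓA ℓK (oK ⟨t, (Γ.ne_of_adj ht).symm⟩ y)) := by
    intro t ht x y
    rw [hg t ht]
    refine Commute.map ?_ (Amalg.inlHom ℓA ℓK)
    exact GraphProduct.commute_of (Γ.induce (insert s₁ (Γ.neighborSet s₁))) (fun t => G t.1)
      (s := ⟨s₁, Set.mem_insert s₁ _⟩) (t := ⟨t, Set.mem_insert_of_mem s₁ ht⟩) ht x y
  obtain ⟨f, hf1, hf2⟩ := exists_split (fun t : S => t) G s₁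
    ((Amalg.inlHom ℓA ℓK).comp (oA ⟨s₁, Set.mem_insert s₁ _⟩))
    (fun t ht => (Amalg.inrHom ℓA ℓK).comp (oK ⟨t, ht⟩))
  obtain ⟨F, hF⟩ := GraphProduct.exists_lift Γ G f (by
      intro s t hst g h
      by_cases h1 : s = s₁
      · subst h1
        rw [hf1 s rfl, hf2 t (Γ.ne_of_adj hst).symm]
        exact hcomm t hst g h
      · by_cases h2 : t = s₁
        · subst h2
          rw [hf1 t rfl, hf2 s h1]
          exact (hcomm s hst.symm h g).symm
        · rw [hf2 s h1, hf2 t h2]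
          refine Commute.map ?_ (Amalg.inrHom ℓA ℓK)
          exact GraphProduct.commute_of (Γ.induce ({s₁}ᶜ : Set S)) (fun t => G t.1)
            (s := ⟨s, h1⟩) (t := ⟨t, h2⟩) hst g h)
  have hr : ψ.comp F = MonoidHom.id _ := by
    refine GraphProduct.hom_ext Γ G _ _ fun t x => ?_
    refine (congrArg ψ (hF _ _)).trans ?_
    by_cases h : t = s₁
    · subst h
      rw [hf1 t rfl]
      exact (h1 _).trans (hιA _ _)
    · rw [hf2 t h]
      exact (h2 _).trans (hιK _ _)
  have hlA : (F.comp ψ).comp (Amalg.inlHom ℓA ℓK) = Amalg.inlHom ℓA ℓK := by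
    refine GraphProduct.hom_ext (Γ.induce (insert s₁ (Γ.neighborSet s₁))) (fun t => G t.1) _ _ ?_
    rintro ⟨t, ht⟩ x
    refine (congrArg F ((h1 _).trans (hιA ⟨t, ht⟩ x))).trans ((hF _ _).trans ?_)
    by_cases h : t = s₁
    · subst h
      rw [hf1 t rfl]
      rfl
    · rw [hf2 t h]
      exact hg t (ht.resolve_left h) x
  have hlK : (F.comp ψ).comp (Amalg.inrHom ℓA ℓK) = Amalg.inrHom ℓA ℓK := by
    refine GraphProduct.hom_ext (Γ.induce ({s₁}ᶜ : Set S)) (fun t => G t.1) _ _ ?_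
    rintro ⟨t, ht⟩ x
    refine (congrArg F ((h2 _).trans (hιK ⟨t, ht⟩ x))).trans ((hF _ _).trans ?_)
    rw [hf2 t ht]
    rfl
  have hl : F.comp ψ = MonoidHom.id _ :=
    Monoid.PushoutI.hom_ext_nonempty (φ := amalgMaps ℓA ℓK) (fun b => match b with
      | true => hlA
      | false => hlK)
  exact Function.bijective_iff_has_inverse.2
    ⟨F, fun y => DFunLike.congr_fun hl y, fun y => DFunLike.congr_fun hr y⟩

/-- Let `Γ` be a simple graph with vertex set `S`, `(G s)` a family of groups with graph
product `G_Γ`, and `s₁ ∈ S`.  Let `L`, `A` and `K` be the graph products over the induced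
subgraphs on `link s₁`, `star s₁` and `S ∖ {s₁}`.  Then:
(a) the homomorphism `G s₁ × L → A` induced by the canonical maps is an isomorphism;
(b) the homomorphism from the pushout of the canonical maps `L → A` and `L → K` to `G_Γ`,
induced by the canonical maps `A → G_Γ` and `K → G_Γ`, is an isomorphism; that is,
`G_Γ ≅ (G s₁ × L) ∗_L K`. -/
theorem graphProduct_amalgam_decomposition {S : Type*} (Γ : SimpleGraph S)
    (G : S → Type*) [∀ s, Group (G s)] (s₁ : S) :
    (∃ θ : G s₁ × LinkProd Γ G s₁ →* StarProd Γ G s₁,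
      (∀ x : G s₁,
        θ (x, 1) =
          GraphProduct.of (Γ.induce (insert s₁ (Γ.neighborSet s₁))) (fun t => G t.1)
            ⟨s₁, Set.mem_insert s₁ _⟩ x) ∧
      (∀ (t : ↥(Γ.neighborSet s₁)) (x : G t.1),
        θ (1, GraphProduct.of (Γ.induce (Γ.neighborSet s₁)) (fun t => G t.1) t x) =
          GraphProduct.of (Γ.induce (insert s₁ (Γ.neighborSet s₁))) (fun t => G t.1)
            ⟨t.1, Set.mem_insert_of_mem s₁ t.2⟩ x) ∧
      Function.Bijective θ) ∧
    (∃ (ℓA : LinkProd Γ G s₁ →* StarProd Γ G s₁)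
       (ℓK : LinkProd Γ G s₁ →* CompProd Γ G s₁)
       (ιA : StarProd Γ G s₁ →* GraphProduct Γ G)
       (ιK : CompProd Γ G s₁ →* GraphProduct Γ G)
       (ψ : Amalg ℓA ℓK →* GraphProduct Γ G),
      (∀ (t : ↥(Γ.neighborSet s₁)) (x : G t.1),
        ℓA (GraphProduct.of (Γ.induce (Γ.neighborSet s₁)) (fun t => G t.1) t x) =
          GraphProduct.of (Γ.induce (insert s₁ (Γ.neighborSet s₁))) (fun t => G t.1)
            ⟨t.1, Set.mem_insert_of_mem s₁ t.2⟩ x) ∧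
      (∀ (t : ↥(Γ.neighborSet s₁)) (x : G t.1),
        ℓK (GraphProduct.of (Γ.induce (Γ.neighborSet s₁)) (fun t => G t.1) t x) =
          GraphProduct.of (Γ.induce ({s₁}ᶜ : Set S)) (fun t => G t.1)
            ⟨t.1, Set.mem_compl_singleton_iff.mpr (Γ.ne_of_adj t.2).symm⟩ x) ∧
      (∀ (a : ↥(insert s₁ (Γ.neighborSet s₁) : Set S)) (x : G a.1),
        ιA (GraphProduct.of (Γ.induce (insert s₁ (Γ.neighborSet s₁))) (fun t => G t.1) a x) =
          GraphProduct.of Γ G a.1 x) ∧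
      (∀ (a : ↥({s₁}ᶜ : Set S)) (x : G a.1),
        ιK (GraphProduct.of (Γ.induce ({s₁}ᶜ : Set S)) (fun t => G t.1) a x) =
          GraphProduct.of Γ G a.1 x) ∧
      (∀ a : StarProd Γ G s₁, ψ (Amalg.inlHom ℓA ℓK a) = ιA a) ∧
      (∀ x : CompProd Γ G s₁, ψ (Amalg.inrHom ℓA ℓK x) = ιK x) ∧
      Function.Bijective ψ) := by
  obtain ⟨ℓA, hA⟩ := GraphProduct.exists_lift (Γ.induce (Γ.neighborSet s₁)) (fun t => G t.1)
    (fun t => GraphProduct.of (Γ.induce (insert s₁ (Γ.neighborSet s₁))) (fun t => G t.1)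
            ⟨t.1, Set.mem_insert_of_mem s₁ t.2⟩)
    (fun s t hst g h => GraphProduct.commute_of
      (Γ.induce (insert s₁ (Γ.neighborSet s₁))) (fun t => G t.1)
      (s := ⟨s.1, Set.mem_insert_of_mem s₁ s.2⟩)
      (t := ⟨t.1, Set.mem_insert_of_mem s₁ t.2⟩) hst g h)
  obtain ⟨ℓK, hK⟩ := GraphProduct.exists_lift (Γ.induce (Γ.neighborSet s₁)) (fun t => G t.1)
    (fun t => GraphProduct.of (Γ.induce ({s₁}ᶜ : Set S)) (fun t => G t.1)
            ⟨t.1, Set.mem_compl_singleton_iff.mpr (Γ.ne_of_adj t.2).symm⟩)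
    (fun s t hst g h => GraphProduct.commute_of
      (Γ.induce ({s₁}ᶜ : Set S)) (fun t => G t.1)
      (s := ⟨s.1, Set.mem_compl_singleton_iff.mpr (Γ.ne_of_adj s.2).symm⟩)
      (t := ⟨t.1, Set.mem_compl_singleton_iff.mpr (Γ.ne_of_adj t.2).symm⟩) hst g h)
  obtain ⟨ιA, hιA⟩ := GraphProduct.exists_lift
    (Γ.induce (insert s₁ (Γ.neighborSet s₁))) (fun t => G t.1)
    (fun t => GraphProduct.of Γ G t.1)
    (fun s t hst g h => GraphProduct.commute_of Γ G (s := s.1) (t := t.1) hst g h)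
  obtain ⟨ιK, hιK⟩ := GraphProduct.exists_lift
    (Γ.induce ({s₁}ᶜ : Set S)) (fun t => G t.1)
    (fun t => GraphProduct.of Γ G t.1)
    (fun s t hst g h => GraphProduct.commute_of Γ G (s := s.1) (t := t.1) hst g h)
  obtain ⟨ψ, h1, h2, h3⟩ := amalg_part Γ G s₁ ℓA ℓK ιA ιK hA hK hιA hιK
  exact ⟨star_part Γ G s₁ ℓA hA, ℓA, ℓK, ιA, ιK, ψ, hA, hK, hιA, hιK, h1, h2, h3⟩
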